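/- Let A be a finite alphabet, L a language over A, and k ≥ 1. Then L ∈ L_{1/2}(k) if and only if L is regular and m^+(L) < k (equivalently, L^+(k) = ∅). -/

import Mathlib

/-- `LPlus L m` is the set of words `v` reachable from some `w₀ ∈ L` by an
`m`-alternating word extension chain with respect to `L`:
`w₀ ⊑ w₁ ⊑ ⋯ ⊑ w_m ⊑ v`, `w₀ ∈ L`, and `wᵢ ∈ L ↔ w_{i+1} ∉ L` for `i < m`. -/
def LPlus {A : Type*} (L : Set (List A)) (m : ℕ) : Set (List A) :=
  {v | ∃ c : ℕ → List A, c 0 ∈ L ∧ (∀ i < m, (c i).Sublist (c (i + 1))) ∧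
    (c m).Sublist v ∧ ∀ i < m, (c i ∈ L ↔ c (i + 1) ∉ L)}

/-- `LMinus L m` is defined like `LPlus L m` but requiring `w₀ ∉ L`. -/
def LMinus {A : Type*} (L : Set (List A)) (m : ℕ) : Set (List A) :=
  {v | ∃ c : ℕ → List A, c 0 ∉ L ∧ (∀ i < m, (c i).Sublist (c (i + 1))) ∧
    (c m).Sublist v ∧ ∀ i < m, (c i ∈ L ↔ c (i + 1) ∉ L)}

/-- A language is regular iff it is accepted by a DFA with a finite state set. -/
def RegularLang {A : Type*} (L : Set (List A)) : Prop :=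
  ∃ (σ : Type) (_ : Fintype σ) (M : DFA A σ), ∀ w : List A, M.eval w ∈ M.accept ↔ w ∈ L

/-- The class `L_{1/2}`: finite unions of sets `⟦w⟧ = {v | w ⊑ v}`. -/
def LhalfClass (A : Type*) : Set (Set (List A)) :=
  {L | ∃ W : Finset (List A), L = ⋃ w ∈ W, {v : List A | w.Sublist v}}

/-- `m⁺(L) = sup {m | L⁺(m) ≠ ∅}`, taken in `ℕ∞ = ℕ ∪ {∞}`. -/
noncomputable def mPlus {A : Type*} (L : Set (List A)) : ℕ∞ :=
  ⨆ m ∈ {m : ℕ | (LPlus L m).Nonempty}, (m : ℕ∞)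

/-- `m⁻(L) = sup {m | L⁻(m) ≠ ∅}`, taken in `ℕ∞ = ℕ ∪ {∞}`. -/
noncomputable def mMinus {A : Type*} (L : Set (List A)) : ℕ∞ :=
  ⨆ m ∈ {m : ℕ | (LMinus L m).Nonempty}, (m : ℕ∞)

/-- The `k`-th level of the boolean hierarchy over a class `C`:
`C(k) = {L₁ Δ L₂ Δ ⋯ Δ L_k | L₁, …, L_k ∈ C}` (`Δ` is symmetric difference). -/
def boolLevel {X : Type*} (C : Set (Set X)) (k : ℕ) : Set (Set X) :=
  {L | ∃ Ls : List (Set X), Ls.length = k ∧ (∀ M ∈ Ls, M ∈ C) ∧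
    L = Ls.foldr symmDiff ∅}

section Regularity

variable {A : Type*}

theorem Language.IsRegular.symmDiff {L M : Language A} (hL : L.IsRegular) (hM : M.IsRegular) :
    Language.IsRegular (symmDiff (α := Set (List A)) L M) :=
  Language.IsRegular.add (Language.IsRegular.inf hL hM.compl) (Language.IsRegular.inf hM hL.compl)

theorem Language.isRegular_empty : Language.IsRegular (∅ : Set (List A)) := by
  refine Language.IsRegular.of_finite_range_leftQuotient
    ((Set.finite_singleton (∅ : Set (List A))).subset ?_)
  rintro _ ⟨x, rfl⟩
  rfl

/-- Every left quotient of `{v | w ⊑ v}` is `{v | s ⊑ v}` for a suffix `s` of `w`. -/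
theorem exists_suffix_setOf_sublist_append (x : List A) : ∀ w : List A,
    ∃ s, s <:+ w ∧ {y | w.Sublist (x ++ y)} = {y | s.Sublist y} := by
  induction x with
  | nil => exact fun w => ⟨w, List.suffix_rfl, rfl⟩
  | cons a x ih =>
    rintro (_ | ⟨b, w⟩)
    · exact ⟨[], List.suffix_rfl, by simp⟩
    · by_cases hab : b = a
      · subst hab
        obtain ⟨s, hs, h⟩ := ih w
        refine ⟨s, hs.trans (List.suffix_cons b w), ?_⟩
        rw [← h]
        ext y
        simp
      · obtain ⟨s, hs, h⟩ := ih (b :: w)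
        refine ⟨s, hs, ?_⟩
        rw [← h]
        ext y
        simp only [List.cons_append, Set.mem_ofPred_eq]
        refine ⟨fun h' => ?_, fun h' => h'.cons a⟩
        cases h' with
        | cons _ h' => exact h'
        | cons_cons _ h' => exact absurd rfl hab

theorem Language.isRegular_setOf_sublist (w : List A) :
    Language.IsRegular {v : List A | w.Sublist v} := by
  refine Language.IsRegular.of_finite_range_leftQuotient (((List.finite_toSet w.tails).image fun s => {y : List A | s.Sublist y}).subset ?_)
  rintro _ ⟨x, rfl⟩
  obtain ⟨s, hs, h⟩ := exists_suffix_setOf_sublist_append x w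
  exact ⟨s, (List.mem_tails _ _).2 hs, h.symm⟩

theorem isRegular_of_mem_LhalfClass {L : Set (List A)} (hL : L ∈ LhalfClass A) :
    Language.IsRegular L := by
  classical
  obtain ⟨W, rfl⟩ := hL
  induction W using Finset.induction_on with
  | empty => simpa using Language.isRegular_empty
  | insert w W _ ih =>
    rw [Finset.set_biUnion_insert]
    exact Language.IsRegular.add (Language.isRegular_setOf_sublist w) ih

theorem isRegular_foldr_symmDiff {Ls : List (Set (List A))} (h : ∀ M ∈ Ls, M ∈ LhalfClass A) :
    Language.IsRegular (Ls.foldr symmDiff ∅ : Set (List A)) := by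
  induction Ls with
  | nil => exact Language.isRegular_empty
  | cons M Ls ih =>
    rw [List.forall_mem_cons] at h
    exact Language.IsRegular.symmDiff (isRegular_of_mem_LhalfClass h.1) (ih h.2)

theorem Language.IsRegular.regularLang {L : Set (List A)} (h : Language.IsRegular L) :
    RegularLang L := by
  obtain ⟨σ, hσ, M, rfl⟩ := h
  exact ⟨σ, hσ, M, fun w => Iff.rfl⟩

end Regularity

section UpwardClosed

variable {A : Type*}

theorem mem_of_sublist_of_mem_LhalfClass {L : Set (List A)} (hL : L ∈ LhalfClass A)
    {u v : List A} (huv : u.Sublist v) (hu : u ∈ L) : v ∈ L := by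
  obtain ⟨W, rfl⟩ := hL
  simp only [Set.mem_iUnion, Set.mem_ofPred_eq, exists_prop] at hu ⊢
  obtain ⟨w, hw, hwu⟩ := hu
  exact ⟨w, hw, hwu.trans huv⟩

/-- Higman's lemma for words over a finite alphabet. -/
theorem finite_of_isAntichain_sublist [Finite A] {S : Set (List A)}
    (hS : IsAntichain List.Sublist S) : S.Finite := by
  have hsub : ∀ u v : List A, List.SublistForall₂ (· = ·) u v ↔ u.Sublist v := fun u v => by
    simp [List.sublistForall₂_iff]
  have hpwo := (Set.toFinite (Set.univ : Set A)).partiallyWellOrderedOn (r := (· = ·))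
    |>.partiallyWellOrderedOn_sublistForall₂
  refine IsAntichain.finite_of_partiallyWellOrderedOn (r := List.SublistForall₂ (· = ·))
    (fun u hu v hv huv h => hS hu hv huv ((hsub u v).1 h)) (hpwo.mono fun u _ x _ => Set.mem_univ x)

theorem mem_LhalfClass_of_upwardClosed [Finite A] {U : Set (List A)}
    (hU : ∀ u v : List A, u.Sublist v → u ∈ U → v ∈ U) : U ∈ LhalfClass A := by
  let S : Set (List A) := {w | w ∈ U ∧ ∀ u ∈ U, u.Sublist w → u = w}
  have hS : S.Finite := finite_of_isAntichain_sublist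
    fun u hu v hv huv h => huv (hv.2 u hu.1 h)
  have hmin : ∀ n, ∀ v ∈ U, v.length = n → ∃ w ∈ S, w.Sublist v := by
    intro n
    induction n using Nat.strong_induction_on with
    | _ n ih =>
      rintro v hv rfl
      by_cases hvS : v ∈ S
      · exact ⟨v, hvS, List.Sublist.refl v⟩
      · obtain ⟨u, hu, huv, hne⟩ : ∃ u ∈ U, u.Sublist v ∧ u ≠ v := by
          by_contra! h
          exact hvS ⟨hv, h⟩
        have hlt : u.length < v.length :=
          lt_of_le_of_ne huv.length_le fun h => hne (huv.eq_of_length h)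
        obtain ⟨w, hw, hwu⟩ := ih _ hlt u hu rfl
        exact ⟨w, hw, hwu.trans huv⟩
  refine ⟨hS.toFinset, ?_⟩
  ext v
  simp only [Set.Finite.mem_toFinset, Set.mem_iUnion, Set.mem_ofPred_eq, exists_prop]
  exact ⟨fun hv => hmin _ v hv rfl, fun ⟨w, hw, hwv⟩ => hU w v hwv hw.1⟩

end UpwardClosed

section Chains

variable {A : Type*} {L : Set (List A)}

theorem mem_LPlus_of_sublist {m : ℕ} (u v : List A) (huv : u.Sublist v) (hu : u ∈ LPlus L m) :
    v ∈ LPlus L m := by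
  obtain ⟨c, h0, hc, hm, halt⟩ := hu
  exact ⟨c, h0, hc, hm.trans huv, halt⟩

theorem LPlus_succ_subset (L : Set (List A)) (m : ℕ) : LPlus L (m + 1) ⊆ LPlus L m := by
  rintro v ⟨c, h0, hc, hm, halt⟩
  exact ⟨c, h0, fun i hi => hc i (by omega), (hc m (by omega)).trans hm,
    fun i hi => halt i (by omega)⟩

theorem LPlus_antitone (L : Set (List A)) : Antitone (LPlus L) :=
  antitone_nat_of_succ_le (LPlus_succ_subset L)

theorem mem_iff_even_of_alternating {c : ℕ → List A} {m : ℕ} (h0 : c 0 ∈ L)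
    (halt : ∀ i < m, (c i ∈ L ↔ c (i + 1) ∉ L)) : c m ∈ L ↔ Even m := by
  induction m with
  | zero => simpa using h0
  | succ m ih =>
    have h1 := halt m (by omega)
    have h2 := ih fun i hi => halt i (by omega)
    rw [Nat.even_add_one]
    tauto

theorem mem_iff_even_of_mem_LPlus {v : List A} {m : ℕ} (hv : v ∈ LPlus L m)
    (hv' : v ∉ LPlus L (m + 1)) : v ∈ L ↔ Even m := by
  obtain ⟨c, h0, hc, hm, halt⟩ := hv
  rw [← mem_iff_even_of_alternating h0 halt]
  by_contra hne
  refine hv' ⟨fun i => if i ≤ m then c i else v, by simpa using h0, ?_, by simp, ?_⟩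
  · intro i hi
    rcases Nat.lt_succ_iff_lt_or_eq.1 hi with hi | rfl
    · simpa [hi.le, Nat.succ_le_of_lt hi] using hc i hi
    · simpa using hm
  · intro i hi
    rcases Nat.lt_succ_iff_lt_or_eq.1 hi with hi | rfl
    · simpa [hi.le, Nat.succ_le_of_lt hi] using halt i hi
    · simp only [le_refl, if_true, Nat.not_succ_le_self, if_false]
      tauto

theorem mPlus_lt_iff {k : ℕ} (hk : 1 ≤ k) : mPlus L < (k : ℕ∞) ↔ LPlus L k = ∅ := by
  constructor
  · intro h
    by_contra hne
    refine h.not_ge ?_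
    exact le_iSup₂_of_le (f := fun (m : ℕ) (_ : m ∈ {m : ℕ | (LPlus L m).Nonempty}) => (m : ℕ∞))
      k (Set.nonempty_iff_ne_empty.2 hne) le_rfl
  · intro h
    have hle : mPlus L ≤ ((k - 1 : ℕ) : ℕ∞) := by
      refine iSup₂_le fun m hm => ?_
      by_contra hlt
      have hkm : k ≤ m := by
        rw [not_le, Nat.cast_lt] at hlt
        omega
      obtain ⟨v, hv⟩ := hm
      simpa [h] using LPlus_antitone L hkm hv
    exact hle.trans_lt (by exact_mod_cast (by omega : k - 1 < k))

end Chains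

section SymmDiff

variable {X : Type*}

theorem foldr_symmDiff_append_singleton (Ls : List (Set X)) (M : Set X) :
    (Ls ++ [M]).foldr symmDiff ∅ = symmDiff (Ls.foldr symmDiff ∅) M := by
  induction Ls with
  | nil => simp [symmDiff_def]
  | cons N Ls ih => simp only [List.cons_append, List.foldr_cons, ih, symmDiff_assoc]

open Classical in
theorem mem_foldr_symmDiff_iff (Ls : List (Set X)) (x : X) :
    x ∈ Ls.foldr symmDiff ∅ ↔ Odd (Ls.countP fun M => x ∈ M) := by
  induction Ls with
  | nil => simp
  | cons M Ls ih =>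
    rw [List.foldr_cons, Set.mem_symmDiff, ih]
    by_cases h : x ∈ M
    · simp [h, Nat.odd_add_one]
    · simp [h]

end SymmDiff

section Hierarchy

variable {A : Type*}

theorem LPlus_length_foldr_symmDiff_eq_empty {Ls : List (Set (List A))}
    (h : ∀ M ∈ Ls, M ∈ LhalfClass A) : LPlus (Ls.foldr symmDiff ∅) Ls.length = ∅ := by
  classical
  rw [Set.eq_empty_iff_forall_notMem]
  rintro v ⟨c, h0, hc, -, halt⟩
  simp only [mem_foldr_symmDiff_iff] at h0 halt
  have hcount : ∀ i ≤ Ls.length, i + 1 ≤ Ls.countP fun M => c i ∈ M := by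
    intro i
    induction i with
    | zero => exact fun _ => h0.pos
    | succ i ih =>
      intro hi
      have hle : (Ls.countP fun M => c i ∈ M) ≤ Ls.countP fun M => c (i + 1) ∈ M :=
        List.countP_mono_left fun M hM hMi => by
          simpa using mem_of_sublist_of_mem_LhalfClass (h M hM) (hc i hi) (by simpa using hMi)
      have hne : (Ls.countP fun M => c i ∈ M) ≠ Ls.countP fun M => c (i + 1) ∈ M := by
        intro heq
        have := halt i hi
        rw [heq] at this
        tauto
      have := ih (by omega)
      omega
  have := hcount Ls.length le_rfl
  have := List.countP_le_length (p := fun M => decide (c Ls.length ∈ M)) (l := Ls)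
  omega

theorem mem_foldr_symmDiff_LPlus_iff {L : Set (List A)} {v : List A} (n : ℕ) :
    (v ∈ LPlus L n → (v ∈ ((List.range n).map (LPlus L)).foldr symmDiff ∅ ↔ Odd n)) ∧
    (v ∉ LPlus L n → (v ∈ ((List.range n).map (LPlus L)).foldr symmDiff ∅ ↔ v ∈ L)) := by
  induction n with
  | zero =>
    refine ⟨fun _ => by simp, fun h => ?_⟩
    simp only [List.range_zero, List.map_nil, List.foldr_nil, Set.mem_empty_iff_false, false_iff]
    exact fun hv => h ⟨fun _ => v, hv, by simp, List.Sublist.refl v, by simp⟩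
  | succ n ih =>
    have hanti : v ∈ LPlus L (n + 1) → v ∈ LPlus L n := fun h => LPlus_succ_subset L n h
    have heven : v ∈ LPlus L n → v ∉ LPlus L (n + 1) → (v ∈ L ↔ Even n) :=
      mem_iff_even_of_mem_LPlus
    rw [List.range_succ, List.map_append, List.map_singleton, foldr_symmDiff_append_singleton,
      Set.mem_symmDiff, Nat.odd_add_one]
    have := Nat.not_odd_iff_even (n := n)
    tauto

theorem eq_foldr_symmDiff_LPlus {L : Set (List A)} {k : ℕ} (h : LPlus L k = ∅) :
    L = ((List.range k).map (LPlus L)).foldr symmDiff ∅ := by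
  ext v
  exact ((mem_foldr_symmDiff_LPlus_iff k).2 (by simp [h])).symm

end Hierarchy

/-- For `k ≥ 1`: `L ∈ L_{1/2}(k)` iff `L` is regular and `m⁺(L) < k`. -/
theorem stmt9 {A : Type*} [Fintype A] (L : Set (List A)) (k : ℕ) (hk : 1 ≤ k) :
    L ∈ boolLevel (LhalfClass A) k ↔ (RegularLang L ∧ mPlus L < (k : ℕ∞)) := by
  rw [mPlus_lt_iff hk]
  constructor
  · rintro ⟨Ls, rfl, hLs, rfl⟩
    exact ⟨(isRegular_foldr_symmDiff hLs).regularLang, LPlus_length_foldr_symmDiff_eq_empty hLs⟩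
  · rintro ⟨-, h⟩
    refine ⟨(List.range k).map (LPlus L), by simp, fun M hM => ?_, eq_foldr_symmDiff_LPlus h⟩
    obtain ⟨m, -, rfl⟩ := List.mem_map.1 hM
    exact mem_LhalfClass_of_upwardClosed mem_LPlus_of_sublist
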